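/- arXiv:1402.2733 — 2 statements merged into one kernel-verified Lean document; each statement's English description precedes it below -/
import Mathlib

section
/- (Entropy rate formula.) Assume 0 < p ≤ P < 1 where p and P are the minimum and maximum entries of E, ε_a > 0 for all a ∈ {1,…,q−1} (with ε_0 = 1), and E_0 is injective. Then the entropy rate H(μ) = lim_{n→∞} S_n/n of the hidden Markov process exists, and there exists a vector Φ ∈ ℝ^{q−1} satisfying the linear system A Φ = b such that H(μ) = Σ_{j=1}^{q−1} Σ_{m=0}^{∞} Σ_{a=0}^{q−1} h_a(Γ_0^m e_j) · c_{j,m} · Φ_j, where S_n = −Σ_{(w_1,…,w_n) ∈ K^n} μ(w) log μ(w) with μ(w) = ⟨τ, E_{w_1}⋯E_{w_n} 𝟙⟩ (and 0·log 0 = 0). -/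
open Matrix BigOperators Filter

/-- The normalized posterior update map `Γ_0(ν) = E_0ᵀ ν / ⟨ν, E_0 𝟙⟩`
(defined whenever the denominator is nonzero). -/
noncomputable def gamma0 {q : ℕ} (E0 : Matrix (Fin q) (Fin q) ℝ) (ν : Fin q → ℝ) :
    Fin q → ℝ :=
  fun c => (Matrix.vecMul ν E0) c / (ν ⬝ᵥ (E0 *ᵥ (fun _ => (1 : ℝ))))


/-- Sum of `f (u E_w)` over all words `w` of length `n`. -/
noncomputable def wordSum {q : ℕ} (EE : Fin q → Matrix (Fin q) (Fin q) ℝ)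
    (f : (Fin q → ℝ) → ℝ) : ℕ → (Fin q → ℝ) → ℝ
  | 0, u => f u
  | n + 1, u => ∑ a, wordSum EE f n (u ᵥ* EE a)

lemma wordSum_sub {q : ℕ} (EE : Fin q → Matrix (Fin q) (Fin q) ℝ)
    (f : (Fin q → ℝ) → ℝ) (n : ℕ) (u : Fin q → ℝ) :
    wordSum EE f (n + 1) u - wordSum EE f n u
      = wordSum EE (fun v => (∑ a, f (v ᵥ* EE a)) - f v) n u := by
  induction n generalizing u with
  | zero => simp [wordSum]
  | succ n ih =>
    rw [wordSum, wordSum, wordSum, ← Finset.sum_sub_distrib]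
    exact Finset.sum_congr rfl fun a _ => ih _

lemma wordSum_eq_sum {q : ℕ} (EE : Fin q → Matrix (Fin q) (Fin q) ℝ)
    (g : ℝ → ℝ) (x : Fin q → ℝ) (n : ℕ) (u : Fin q → ℝ) :
    ∑ w : Fin n → Fin q, g (u ⬝ᵥ ((List.ofFn (fun i => EE (w i))).prod *ᵥ x))
      = wordSum EE (fun v => g (v ⬝ᵥ x)) n u := by
  induction n generalizing u with
  | zero => simp [wordSum]
  | succ n ih =>
    rw [wordSum, ← (Fin.consEquiv (fun _ : Fin (n + 1) => Fin q)).sum_comp, Fintype.sum_prod_type]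
    refine Finset.sum_congr rfl fun a _ => ?_
    rw [← ih]
    refine Finset.sum_congr rfl fun w _ => ?_
    simp only [Fin.consEquiv, Equiv.coe_fn_mk, List.ofFn_succ, Fin.cons_zero, Fin.cons_succ,
      List.prod_cons]
    rw [← Matrix.mulVec_mulVec, Matrix.dotProduct_mulVec u]

lemma wordSum_formula {q : ℕ} [NeZero q] (E : Matrix (Fin q) (Fin q) ℝ)
    (EE : Fin q → Matrix (Fin q) (Fin q) ℝ) (κ : Fin q → ℝ)
    (hsum : ∑ a, EE a = E)
    (hEE : ∀ a, a ≠ 0 → ∀ u, u ᵥ* EE a = (u a * κ a) • E a)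
    (f : (Fin q → ℝ) → ℝ) (hf : ∀ (t : ℝ) u, f (t • u) = t * f u) (n : ℕ) (u : Fin q → ℝ) :
    wordSum EE f n u = f (u ᵥ* EE 0 ^ n) + ∑ m ∈ Finset.range n, ∑ j : {j : Fin q // j ≠ 0},
      (u ᵥ* E ^ (n - 1 - m)) j.val * κ j.val * f (E j.val ᵥ* EE 0 ^ m) := by
  induction n generalizing u with
  | zero => simp [wordSum]
  | succ n ih =>
    have key : ∀ M : Matrix (Fin q) (Fin q) ℝ, ∀ j,
        ∑ a, (u ᵥ* EE a ᵥ* M) j = (u ᵥ* (E * M)) j := by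
      intro M j
      rw [← hsum, Finset.sum_mul, ← Finset.sum_apply]
      simp only [Matrix.vecMul_vecMul]
      exact congrFun (Matrix.vecMul_sum u _ _).symm j
    rw [wordSum]
    simp only [ih]
    rw [Finset.sum_add_distrib, Fintype.sum_eq_add_sum_subtype_ne _ (0 : Fin q),
      Matrix.vecMul_vecMul, ← pow_succ', Finset.sum_range_succ, Finset.sum_comm, add_assoc,
      add_comm (∑ m ∈ Finset.range n, _)]
    congr 2
    · refine Finset.sum_congr rfl fun j _ => ?_
      rw [hEE j.val j.2, Matrix.smul_vecMul, hf]
      simp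
    · refine Finset.sum_congr rfl fun m hm => ?_
      rw [Finset.sum_comm]
      refine Finset.sum_congr rfl fun j _ => ?_
      rw [← Finset.sum_mul, ← Finset.sum_mul, key, ← pow_succ']
      have : n - 1 - m + 1 = n + 1 - 1 - m := by
        have := Finset.mem_range.1 hm
        omega
      rw [this]

lemma cond_ent_hom {q : ℕ} (EE : Fin q → Matrix (Fin q) (Fin q) ℝ)
    (hs : ∀ v : Fin q → ℝ, ∑ a, (v ᵥ* EE a) ⬝ᵥ (fun _ => (1 : ℝ)) = v ⬝ᵥ (fun _ => (1 : ℝ)))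
    (t : ℝ) (u : Fin q → ℝ) :
    (∑ a, Real.negMulLog (((t • u) ᵥ* EE a) ⬝ᵥ (fun _ => (1 : ℝ))))
        - Real.negMulLog ((t • u) ⬝ᵥ (fun _ => (1 : ℝ)))
      = t * ((∑ a, Real.negMulLog ((u ᵥ* EE a) ⬝ᵥ (fun _ => (1 : ℝ))))
        - Real.negMulLog (u ⬝ᵥ (fun _ => (1 : ℝ)))) := by
  simp only [Matrix.smul_vecMul, smul_dotProduct, smul_eq_mul, Real.negMulLog_mul]
  rw [Finset.sum_add_distrib, ← Finset.sum_mul, ← Finset.mul_sum, hs]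
  ring

lemma vecMul_nonneg' {q : ℕ} (M : Matrix (Fin q) (Fin q) ℝ) (hM : ∀ i j, 0 ≤ M i j)
    (u : Fin q → ℝ) (hu : ∀ i, 0 ≤ u i) (i : Fin q) : 0 ≤ (u ᵥ* M) i := by
  rw [Matrix.vecMul, dotProduct]
  exact Finset.sum_nonneg fun k _ => mul_nonneg (hu k) (hM k i)

lemma vecMul_pow_nonneg {q : ℕ} (M : Matrix (Fin q) (Fin q) ℝ) (hM : ∀ i j, 0 ≤ M i j)
    (u : Fin q → ℝ) (hu : ∀ i, 0 ≤ u i) (n : ℕ) (i : Fin q) : 0 ≤ (u ᵥ* M ^ n) i := by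
  induction n generalizing i with
  | zero => simpa using hu i
  | succ n ih =>
    rw [pow_succ, ← Matrix.vecMul_vecMul]
    exact vecMul_nonneg' M hM _ ih i

lemma cond_ent_bound {q : ℕ} (EE : Fin q → Matrix (Fin q) (Fin q) ℝ)
    (hEE : ∀ a i j, 0 ≤ EE a i j)
    (hs : ∀ v : Fin q → ℝ, ∑ a, (v ᵥ* EE a) ⬝ᵥ (fun _ => (1 : ℝ)) = v ⬝ᵥ (fun _ => (1 : ℝ)))
    (u : Fin q → ℝ) (hu : ∀ i, 0 ≤ u i) :
    |(∑ a, Real.negMulLog ((u ᵥ* EE a) ⬝ᵥ (fun _ => (1 : ℝ))))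
        - Real.negMulLog (u ⬝ᵥ (fun _ => (1 : ℝ)))| ≤ q * (u ⬝ᵥ (fun _ => (1 : ℝ))) := by
  have hdot : ∀ v : Fin q → ℝ, (∀ i, 0 ≤ v i) → 0 ≤ v ⬝ᵥ (fun _ => (1 : ℝ)) := by
    intro v hv
    exact Finset.sum_nonneg fun i _ => mul_nonneg (hv i) zero_le_one
  set s := u ⬝ᵥ (fun _ => (1 : ℝ)) with hsdef
  have hs0 : 0 ≤ s := hdot u hu
  rcases hs0.eq_or_lt with h0 | hpos
  · have hz : u = 0 := by
      ext i
      have : ∑ i, u i = 0 := by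
        rw [h0, hsdef]; simp [dotProduct]
      exact (Finset.sum_eq_zero_iff_of_nonneg fun i _ => hu i).1 this i (Finset.mem_univ i)
    rw [← h0]
    simp [hz]
  · have hus : u = s • (s⁻¹ • u) := by rw [smul_smul, mul_inv_cancel₀ hpos.ne', one_smul]
    set v := s⁻¹ • u with hv
    have hv0 : ∀ i, 0 ≤ v i := fun i => mul_nonneg (inv_nonneg.2 hs0) (hu i)
    have hv1 : v ⬝ᵥ (fun _ => (1 : ℝ)) = 1 := by
      rw [hv, smul_dotProduct, ← hsdef, smul_eq_mul, inv_mul_cancel₀ hpos.ne']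
    have hom := cond_ent_hom EE hs s v
    rw [← hus, ← hsdef] at hom
    rw [hom, hv1, Real.negMulLog_one, sub_zero, abs_mul, abs_of_pos hpos, mul_comm]
    refine mul_le_mul_of_nonneg_right ?_ hs0
    have hx0 : ∀ a, 0 ≤ (v ᵥ* EE a) ⬝ᵥ (fun _ => (1 : ℝ)) :=
      fun a => hdot _ (vecMul_nonneg' _ (hEE a) _ hv0)
    have hx1 : ∀ a, (v ᵥ* EE a) ⬝ᵥ (fun _ => (1 : ℝ)) ≤ 1 := by
      intro a
      refine le_trans ?_ ((hs v).trans hv1).le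
      exact Finset.single_le_sum (f := fun a => (v ᵥ* EE a) ⬝ᵥ (fun _ => (1 : ℝ)))
        (fun a _ => hx0 a) (Finset.mem_univ a)
    calc _ ≤ ∑ a : Fin q, |Real.negMulLog ((v ᵥ* EE a) ⬝ᵥ (fun _ => (1 : ℝ)))| :=
          Finset.abs_sum_le_sum_abs _ _
      _ ≤ ∑ a : Fin q, (1 : ℝ) := by
          refine Finset.sum_le_sum fun a _ => ?_
          rw [abs_of_nonneg (Real.negMulLog_nonneg (hx0 a) (hx1 a))]
          have := Real.negMulLog_le_one_sub_self (hx0 a)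
          linarith [hx0 a]
      _ = q := by simp

lemma gamma_iter {q : ℕ} [NeZero q] (E0 : Matrix (Fin q) (Fin q) ℝ) (hM : ∀ i j, 0 < E0 i j)
    (ν : Fin q → ℝ) (hν : ∀ i, 0 < ν i) (hν1 : ν ⬝ᵥ (fun _ => (1 : ℝ)) = 1) (m : ℕ) :
    (∀ i, 0 < (gamma0 E0)^[m] ν i) ∧ (gamma0 E0)^[m] ν ⬝ᵥ (fun _ => (1 : ℝ)) = 1 ∧
    (∏ k ∈ Finset.range m, ((gamma0 E0)^[k] ν) ⬝ᵥ (E0 *ᵥ (fun _ => (1 : ℝ)))) •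
      ((gamma0 E0)^[m] ν) = ν ᵥ* E0 ^ m := by
  induction m with
  | zero => simpa using ⟨hν, hν1⟩
  | succ m ih =>
    obtain ⟨h1, h2, h3⟩ := ih
    rw [Function.iterate_succ_apply', Finset.prod_range_succ, pow_succ, ← Matrix.vecMul_vecMul,
      ← h3]
    set x := (gamma0 E0)^[m] ν
    have hv : ∀ i, 0 < (x ᵥ* E0) i := fun i =>
      Finset.sum_pos (fun k _ => mul_pos (h1 k) (hM k i)) Finset.univ_nonempty
    have hd : 0 < x ⬝ᵥ (E0 *ᵥ (fun _ => (1 : ℝ))) := by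
      rw [Matrix.dotProduct_mulVec]
      exact Finset.sum_pos (fun k _ => mul_pos (hv k) one_pos) Finset.univ_nonempty
    have hg : gamma0 E0 x = (x ⬝ᵥ (E0 *ᵥ (fun _ => (1 : ℝ))))⁻¹ • (x ᵥ* E0) := by
      ext i; simp [gamma0, div_eq_inv_mul]
    refine ⟨fun i => div_pos (hv i) hd, ?_, ?_⟩
    · rw [hg, smul_dotProduct, ← Matrix.dotProduct_mulVec, smul_eq_mul, inv_mul_cancel₀ hd.ne']
    · rw [hg, smul_smul, mul_assoc, mul_inv_cancel₀ hd.ne', mul_one, Matrix.smul_vecMul]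

/-- **Entropy rate formula.** Assume all entries of the row-stochastic
matrix `E` lie strictly between `0` and `1` (i.e. `0 < p ≤ P < 1`), `ε_a ∈ (0,1)` for
`a ∈ {1,…,q-1}` (with `ε_0 = 1`), and `E_0` is injective. Then the entropy rate
`H(μ) = lim_{n→∞} S_n / n` of the hidden Markov process exists, and there is a vector
`Φ ∈ ℝ^{q-1}` solving the linear system `A Φ = b` (rows `i = 1,…,q-1`:
`Σ_j (-δ_{ij} + Σ_m ⟨Γ_0^m e_j, E_i 𝟙⟩ c_{j,m}) Φ_j = 0` for `q ≠ 2`, and `Σ_j 0 ⬝ Φ_j = 0`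
for `q = 2`; last row: `Σ_j (Σ_m c_{j,m}) Φ_j = 1`) such that
`H(μ) = Σ_{j=1}^{q-1} Σ_{m=0}^{∞} Σ_{a=0}^{q-1} h_a(Γ_0^m e_j) c_{j,m} Φ_j`.
Here `S_n = -Σ_{w ∈ K^n} μ(w) log μ(w)` with `μ(w) = ⟨τ, E_{w_1}⋯E_{w_n} 𝟙⟩`
(with the convention `0 log 0 = 0`, via `Real.negMulLog`). -/
theorem entropy_rate_formula
    (q : ℕ) [NeZero q] (hq : 2 ≤ q)
    (E : Matrix (Fin q) (Fin q) ℝ)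
    (hE_pos : ∀ i j, 0 < E i j)
    (hE_lt_one : ∀ i j, E i j < 1)
    (hE_rows : ∀ i, ∑ j, E i j = 1)
    (τ : Fin q → ℝ)
    (hτ_nonneg : ∀ i, 0 ≤ τ i)
    (hτ_sum : ∑ i, τ i = 1)
    (hτ_stat : Matrix.vecMul τ E = τ)
    (F : Fin q → Matrix (Fin q) (Fin q) ℝ)
    (hF : ∀ a b c, F a b c = if a = b then E a c else 0)
    (eps : Fin q → ℝ)
    (heps0 : eps 0 = 1)
    (heps : ∀ a : Fin q, a ≠ 0 → 0 < eps a ∧ eps a < 1)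
    (EE : Fin q → Matrix (Fin q) (Fin q) ℝ)
    (hEE0 : EE 0 = F 0 + ∑ a ∈ Finset.univ.erase 0, eps a • F a)
    (hEEa : ∀ a : Fin q, a ≠ 0 → EE a = (1 - eps a) • F a)
    (hinj : Function.Injective fun v : Fin q → ℝ => (EE 0) *ᵥ v)
    (c : Fin q → ℕ → ℝ)
    (hc : ∀ j m, c j m = ∏ i ∈ Finset.Icc 1 m,
        ((gamma0 (EE 0))^[m - i] (E j)) ⬝ᵥ ((EE 0) *ᵥ (fun _ => (1 : ℝ))))
    (h : Fin q → (Fin q → ℝ) → ℝ)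
    (hh : ∀ a ν, h a ν = -(ν ⬝ᵥ ((EE a) *ᵥ (fun _ => (1 : ℝ)))) *
        Real.log (ν ⬝ᵥ ((EE a) *ᵥ (fun _ => (1 : ℝ)))))
    (S : ℕ → ℝ)
    (hS : ∀ n : ℕ, S n = ∑ w : Fin n → Fin q,
        Real.negMulLog (τ ⬝ᵥ ((List.ofFn (fun i => EE (w i))).prod *ᵥ (fun _ => (1 : ℝ))))) :
    ∃ H : ℝ,
      Tendsto (fun n : ℕ => S n / n) atTop (nhds H) ∧
      ∃ Φ : {j : Fin q // j ≠ 0} → ℝ,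
        (∀ i : Fin q, i ≠ 0 →
          ∑ j : {j : Fin q // j ≠ 0},
            (if q = 2 then 0 else
              ((if i = j.val then (-1 : ℝ) else 0) +
                ∑' m : ℕ,
                  (((gamma0 (EE 0))^[m] (E j.val)) ⬝ᵥ ((EE i) *ᵥ (fun _ => (1 : ℝ)))) *
                    c j.val m)) * Φ j = 0) ∧
        (∑ j : {j : Fin q // j ≠ 0}, (∑' m : ℕ, c j.val m) * Φ j = 1) ∧
        H = ∑ j : {j : Fin q // j ≠ 0},
              (∑' m : ℕ, ∑ a : Fin q, h a ((gamma0 (EE 0))^[m] (E j.val)) * c j.val m) *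
                Φ j := by
  have hF' : ∀ a, ∀ u : Fin q → ℝ, u ᵥ* F a = u a • E a := by
    intro a u
    ext c
    simp [Matrix.vecMul, dotProduct, hF]
  have hsum : ∑ a, EE a = E := by
    have h1 : ∑ a, EE a = ∑ a, F a := by
      rw [← Finset.add_sum_erase _ EE (Finset.mem_univ 0), hEE0,
        ← Finset.add_sum_erase _ F (Finset.mem_univ 0), add_assoc, ← Finset.sum_add_distrib]
      congr 1
      refine Finset.sum_congr rfl fun a ha => ?_
      rw [hEEa a (Finset.ne_of_mem_erase ha), ← add_smul]
      simp
    rw [h1]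
    ext i j
    simp [Matrix.sum_apply, hF]
  have hE0 : ∀ i j, EE 0 i j = eps i * E i j := by
    intro i j
    have : EE 0 = ∑ a, eps a • F a := by
      rw [hEE0, ← Finset.add_sum_erase _ _ (Finset.mem_univ 0), heps0, one_smul]
    rw [this]
    simp [Matrix.sum_apply, hF]
  have hepos : ∀ a, 0 < eps a := by
    intro a
    by_cases ha : a = 0
    · rw [ha, heps0]; exact one_pos
    · exact (heps a ha).1
  have hele : ∀ a, eps a ≤ 1 := by
    intro a
    by_cases ha : a = 0
    · rw [ha, heps0]
    · exact (heps a ha).2.le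
  have hE0pos : ∀ i j, 0 < EE 0 i j := fun i j => by
    rw [hE0]; exact mul_pos (hepos i) (hE_pos i j)
  have hEEnn : ∀ a i j, 0 ≤ EE a i j := by
    intro a i j
    by_cases ha : a = 0
    · rw [ha]; exact (hE0pos i j).le
    · rw [hEEa a ha, Matrix.smul_apply, hF, smul_eq_mul]
      refine mul_nonneg (by linarith [hele a]) ?_
      split_ifs
      · exact (hE_pos _ _).le
      · exact le_rfl
  have hEEv : ∀ a, a ≠ 0 → ∀ u : Fin q → ℝ, u ᵥ* EE a = (u a * (1 - eps a)) • E a := by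
    intro a ha u
    rw [hEEa a ha, Matrix.vecMul_smul, hF', smul_smul, mul_comm]
  have hE1 : E *ᵥ (fun _ => (1 : ℝ)) = fun _ => 1 := by
    ext i; simp [Matrix.mulVec, dotProduct, hE_rows]
  have hsumv : ∀ v x : Fin q → ℝ, ∑ a, (v ᵥ* EE a) ⬝ᵥ x = (v ᵥ* E) ⬝ᵥ x := by
    intro v x
    rw [← hsum, Matrix.vecMul_sum, sum_dotProduct]
  have hs : ∀ v : Fin q → ℝ,
      ∑ a, (v ᵥ* EE a) ⬝ᵥ (fun _ => (1 : ℝ)) = v ⬝ᵥ (fun _ => (1 : ℝ)) := by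
    intro v
    rw [hsumv, ← Matrix.dotProduct_mulVec, hE1]
  -- geometric decay
  obtain ⟨ρ, hρ0, hρ1, hρ⟩ : ∃ ρ : ℝ, 0 ≤ ρ ∧ ρ < 1 ∧ ∀ i, ∑ k, E i k * eps k ≤ ρ := by
    obtain ⟨i0, -, hi0⟩ := Finset.exists_max_image Finset.univ (fun i => ∑ k, E i k * eps k)
      Finset.univ_nonempty
    refine ⟨∑ k, E i0 k * eps k, Finset.sum_nonneg fun k _ =>
      mul_nonneg (hE_pos _ _).le (hepos k).le, ?_, fun i => hi0 i (Finset.mem_univ i)⟩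
    rw [← hE_rows i0]
    have h10 : (⟨1, hq⟩ : Fin q) ≠ 0 := by
      intro h
      have := congrArg Fin.val h
      simp at this
    refine Finset.sum_lt_sum (fun k _ => mul_le_of_le_one_right (hE_pos _ _).le (hele k))
      ⟨⟨1, hq⟩, Finset.mem_univ _, ?_⟩
    exact mul_lt_of_lt_one_right (hE_pos _ _) (heps _ h10).2
  have hdecay : ∀ m i, (E *ᵥ (EE 0 ^ m *ᵥ (fun _ => (1 : ℝ)))) i ≤ ρ ^ m := by
    intro m
    induction m with
    | zero => intro i; simp [hE1]
    | succ m ih =>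
      intro i
      set y := EE 0 ^ m *ᵥ (fun _ => (1 : ℝ)) with hy
      have e1 : EE 0 ^ (m + 1) *ᵥ (fun _ => (1 : ℝ)) = fun k => eps k * (E *ᵥ y) k := by
        rw [pow_succ', ← Matrix.mulVec_mulVec, ← hy]
        ext k
        simp [Matrix.mulVec, dotProduct, hE0, Finset.mul_sum, mul_assoc]
      rw [e1]
      calc _ = ∑ k, E i k * (eps k * (E *ᵥ y) k) := rfl
        _ ≤ ∑ k, E i k * (eps k * ρ ^ m) := Finset.sum_le_sum fun k _ =>
            mul_le_mul_of_nonneg_left (mul_le_mul_of_nonneg_left (ih k) (hepos k).le)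
              (hE_pos _ _).le
        _ = (∑ k, E i k * eps k) * ρ ^ m := by
            rw [Finset.sum_mul]; exact Finset.sum_congr rfl fun k _ => by ring
        _ ≤ ρ * ρ ^ m := mul_le_mul_of_nonneg_right (hρ i) (pow_nonneg hρ0 m)
        _ = ρ ^ (m + 1) := (pow_succ' ρ m).symm
  have hdecE : ∀ j m, (E j ᵥ* EE 0 ^ m) ⬝ᵥ (fun _ => (1 : ℝ)) ≤ ρ ^ m := by
    intro j m
    rw [← Matrix.dotProduct_mulVec]
    exact hdecay m j
  have hdecτ : ∀ m, (τ ᵥ* EE 0 ^ m) ⬝ᵥ (fun _ => (1 : ℝ)) ≤ ρ ^ m := by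
    intro m
    rw [← hτ_stat, ← Matrix.dotProduct_mulVec, ← Matrix.dotProduct_mulVec]
    calc _ ≤ ∑ k, τ k * ρ ^ m := Finset.sum_le_sum fun k _ =>
          mul_le_mul_of_nonneg_left (hdecay m k) (hτ_nonneg k)
      _ = ρ ^ m := by rw [← Finset.sum_mul, hτ_sum, one_mul]
  have hτpow : ∀ n, τ ᵥ* E ^ n = τ := by
    intro n
    induction n with
    | zero => simp
    | succ n ih => rw [pow_succ, ← Matrix.vecMul_vecMul, ih, hτ_stat]
  have hgeo := tendsto_pow_atTop_nhds_zero_of_lt_one hρ0 hρ1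
  have hE0nn : ∀ i j, 0 ≤ EE 0 i j := fun i j => (hE0pos i j).le
  -- main limit
  have hsumm : ∀ (f : (Fin q → ℝ) → ℝ) (C : ℝ), 0 ≤ C →
      (∀ u : Fin q → ℝ, (∀ i, 0 ≤ u i) → |f u| ≤ C * (u ⬝ᵥ (fun _ => (1 : ℝ)))) → ∀ j,
      Summable fun m => f (E j ᵥ* EE 0 ^ m) := by
    intro f C hC hf j
    refine Summable.of_norm_bounded (g := fun m => C * ρ ^ m)
      ((summable_geometric_of_lt_one hρ0 hρ1).mul_left C) fun m => ?_
    rw [Real.norm_eq_abs]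
    exact (hf _ (vecMul_pow_nonneg _ hE0nn _ (fun i => (hE_pos j i).le) m)).trans
      (mul_le_mul_of_nonneg_left (hdecE j m) hC)
  have hmain : ∀ (f : (Fin q → ℝ) → ℝ) (C : ℝ), 0 ≤ C → (∀ (t : ℝ) u, f (t • u) = t * f u) →
      (∀ u : Fin q → ℝ, (∀ i, 0 ≤ u i) → |f u| ≤ C * (u ⬝ᵥ (fun _ => (1 : ℝ)))) →
      Tendsto (fun n => wordSum EE f n τ) atTop
        (nhds (∑ j : {j : Fin q // j ≠ 0}, (∑' m : ℕ, f (E j.val ᵥ* EE 0 ^ m)) *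
          (τ j.val * (1 - eps j.val)))) := by
    intro f C hC hf hb
    have e : (fun n => wordSum EE f n τ) = fun n => f (τ ᵥ* EE 0 ^ n) +
        ∑ j : {j : Fin q // j ≠ 0}, (∑ m ∈ Finset.range n, f (E j.val ᵥ* EE 0 ^ m)) *
          (τ j.val * (1 - eps j.val)) := by
      ext n
      rw [wordSum_formula E EE (fun a => 1 - eps a) hsum hEEv f hf, Finset.sum_comm]
      congr 1
      refine Finset.sum_congr rfl fun j _ => ?_
      rw [Finset.sum_mul]
      refine Finset.sum_congr rfl fun m _ => ?_
      rw [hτpow, mul_comm]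
    rw [e, ← zero_add (∑ j : {j : Fin q // j ≠ 0}, _)]
    refine Tendsto.add ?_ ?_
    · have hz : Tendsto (fun n => C * ρ ^ n) atTop (nhds 0) := by
        simpa using hgeo.const_mul C
      refine squeeze_zero_norm (fun n => ?_) hz
      rw [Real.norm_eq_abs]
      exact (hb _ (vecMul_pow_nonneg _ hE0nn _ hτ_nonneg n)).trans
        (mul_le_mul_of_nonneg_left (hdecτ n) hC)
    · exact tendsto_finsetSum _ fun j _ =>
        ((hsumm f C hC hb j.val).hasSum.tendsto_sum_nat).mul_const _
  -- linear functionals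
  have hlin : ∀ x : Fin q → ℝ, (∀ i, 0 ≤ x i) → (∀ i, x i ≤ 1) →
      ∑ j : {j : Fin q // j ≠ 0}, (∑' m : ℕ, (E j.val ᵥ* EE 0 ^ m) ⬝ᵥ x) *
          (τ j.val * (1 - eps j.val)) = τ ⬝ᵥ x := by
    intro x hx0 hx1
    have hw : ∀ n u, wordSum EE (fun v => v ⬝ᵥ x) n u = (u ᵥ* E ^ n) ⬝ᵥ x := by
      intro n
      induction n with
      | zero => intro u; simp [wordSum]
      | succ n ih =>
        intro u
        rw [wordSum]
        simp only [ih, ← Matrix.dotProduct_mulVec]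
        rw [pow_succ', ← Matrix.mulVec_mulVec, Matrix.dotProduct_mulVec u, ← hsumv]
        simp only [← Matrix.dotProduct_mulVec]
    have hl := hmain (fun v => v ⬝ᵥ x) 1 zero_le_one (fun t u => by simp) (fun u hu => by
      have hux : 0 ≤ u ⬝ᵥ x := Finset.sum_nonneg fun i _ => mul_nonneg (hu i) (hx0 i)
      rw [one_mul, abs_of_nonneg hux]
      exact Finset.sum_le_sum fun i _ => mul_le_mul_of_nonneg_left (hx1 i) (hu i))
    simp only [hw, hτpow] at hl
    exact tendsto_nhds_unique hl tendsto_const_nhds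
  -- identification of `c`
  have hEj1 : ∀ j, E j ⬝ᵥ (fun _ => (1 : ℝ)) = 1 := fun j => by simp [dotProduct, hE_rows]
  have hcr : ∀ j m, c j m = ∏ k ∈ Finset.range m,
      ((gamma0 (EE 0))^[k] (E j)) ⬝ᵥ ((EE 0) *ᵥ (fun _ => (1 : ℝ))) := by
    intro j m
    rw [hc, ← Finset.prod_range_reflect, ← Finset.Ico_add_one_right_eq_Icc,
      Finset.prod_Ico_eq_prod_range]
    refine Finset.prod_congr (by simp) fun k _ => ?_
    rw [Nat.sub_sub]
  have hgi : ∀ j m, (∀ i, 0 < (gamma0 (EE 0))^[m] (E j) i) ∧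
      (gamma0 (EE 0))^[m] (E j) ⬝ᵥ (fun _ => (1 : ℝ)) = 1 ∧
      c j m • ((gamma0 (EE 0))^[m] (E j)) = E j ᵥ* EE 0 ^ m := by
    intro j m
    rw [hcr]
    exact gamma_iter (EE 0) hE0pos (E j) (hE_pos j) (hEj1 j) m
  have hcx : ∀ (j : Fin q) (m : ℕ) (x : Fin q → ℝ),
      ((gamma0 (EE 0))^[m] (E j) ⬝ᵥ x) * c j m = (E j ᵥ* EE 0 ^ m) ⬝ᵥ x := by
    intro j m x
    rw [← (hgi j m).2.2, smul_dotProduct, smul_eq_mul, mul_comm]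
  have hc1 : ∀ j m, c j m = (E j ᵥ* EE 0 ^ m) ⬝ᵥ (fun _ => (1 : ℝ)) := by
    intro j m
    rw [← hcx, (hgi j m).2.1, one_mul]
  -- conditional entropy functional
  set L : (Fin q → ℝ) → ℝ := fun v =>
    (∑ a, Real.negMulLog ((v ᵥ* EE a) ⬝ᵥ (fun _ => (1 : ℝ))))
        - Real.negMulLog (v ⬝ᵥ (fun _ => (1 : ℝ))) with hL
  have hLh : ∀ (t : ℝ) u, L (t • u) = t * L u := cond_ent_hom EE hs
  have hLc : ∀ j m, ∑ a : Fin q, h a ((gamma0 (EE 0))^[m] (E j)) * c j m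
      = L (E j ᵥ* EE 0 ^ m) := by
    intro j m
    rw [← (hgi j m).2.2, hLh, ← Finset.sum_mul, mul_comm]
    congr 1
    simp only [hL, (hgi j m).2.1, Real.negMulLog_one, sub_zero]
    refine Finset.sum_congr rfl fun a _ => ?_
    rw [hh, Real.negMulLog, Matrix.dotProduct_mulVec]
  have hLlim := hmain L q (Nat.cast_nonneg q) hLh (cond_ent_bound EE hEEnn hs)
  refine ⟨∑ j : {j : Fin q // j ≠ 0}, (∑' m : ℕ, L (E j.val ᵥ* EE 0 ^ m)) *
          (τ j.val * (1 - eps j.val)), ?_, fun j => τ j.val * (1 - eps j.val), ?_, ?_, ?_⟩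
  · have hSW : ∀ n, S n = wordSum EE
        (fun v => Real.negMulLog (v ⬝ᵥ (fun _ => (1 : ℝ)))) n τ := by
      intro n
      rw [hS]
      exact wordSum_eq_sum EE Real.negMulLog _ n τ
    have hd : ∀ n, wordSum EE L n τ = S (n + 1) - S n := by
      intro n
      rw [hSW, hSW, wordSum_sub]
    have hces := hLlim.cesaro
    refine hces.congr fun n => ?_
    simp only [hd]
    rw [Finset.sum_range_sub]
    have : S 0 = 0 := by
      rw [hSW]
      simp [wordSum, dotProduct, hτ_sum]
    rw [this, sub_zero, div_eq_inv_mul]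
  · intro i hi
    split_ifs with h2
    · simp
    · have hx : EE i *ᵥ (fun _ => (1 : ℝ)) = fun k => if k = i then 1 - eps i else 0 := by
        ext k
        rw [hEEa i hi]
        by_cases hk : k = i
        · subst hk
          simp [Matrix.mulVec, dotProduct, hF, ← Finset.mul_sum, hE_rows]
        · simp [Matrix.mulVec, dotProduct, hF, hk, Ne.symm hk]
      have hl := hlin (EE i *ᵥ (fun _ => (1 : ℝ)))
        (fun k => by rw [hx]; dsimp only; split_ifs <;> linarith [hele i])
        (fun k => by rw [hx]; dsimp only; split_ifs <;> linarith [hepos i])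
      simp only [hcx, add_mul, Finset.sum_add_distrib]
      rw [hl, Finset.sum_eq_single (⟨i, hi⟩ : {j : Fin q // j ≠ 0})]
      · rw [hx]
        simp [dotProduct]
      · intro b _ hb
        rw [if_neg, zero_mul]
        intro hib
        exact hb (Subtype.ext hib.symm)
      · intro hn
        exact absurd (Finset.mem_univ _) hn
  · simp only [hc1]
    rw [hlin _ (fun _ => zero_le_one) (fun _ => le_rfl)]
    simp [dotProduct, hτ_sum]
  · simp only [hLc]
end

section
/- Let X_1,…,X_n and Z_1,…,Z_n be random variables taking values in ZMod 2 on a probability space, with the random vector (X_1,…,X_n) independent of the random vector (Z_1,…,Z_n), and define Y_i = X_i + Z_i (addition in ZMod 2). Then for every 1 ≤ i ≤ n, the conditional entropy satisfies H[Y_i | (X_1,…,X_i, Y_1,…,Y_{i−1})] = H[Z_i | (Z_1,…,Z_{i−1})]. -/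
open MeasureTheory ProbabilityTheory

/-- Shannon entropy (natural logarithm) of a finite-valued random variable `U` under the
measure `μ`: `H[U] = Σ_s negMulLog P(U = s)`. -/
noncomputable def ent {Ω S : Type*} [MeasurableSpace Ω] [Fintype S]
    (μ : Measure Ω) (U : Ω → S) : ℝ :=
  ∑ s : S, Real.negMulLog (μ (U ⁻¹' {s})).toReal

/-- Conditional Shannon entropy (natural logarithm):
`H[U | V] = Σ_v P(V = v) ⬝ H[U | V = v]`. -/
noncomputable def condEnt {Ω S T : Type*} [MeasurableSpace Ω] [Fintype S] [Fintype T]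
    (μ : Measure Ω) (U : Ω → S) (V : Ω → T) : ℝ :=
  ∑ t : T, (μ (V ⁻¹' {t})).toReal *
    ∑ s : S, Real.negMulLog ((μ (U ⁻¹' {s} ∩ V ⁻¹' {t})).toReal / (μ (V ⁻¹' {t})).toReal)

/-- Abstract form: `A` is independent of `(B, W)`, and `(A, C)`, `V` are obtained from
`A, B, W` by translations depending only on `A`. -/
theorem condEnt_translate_aux {Ω α β S : Type*} [MeasurableSpace Ω] [Fintype α] [Fintype β]
    [Fintype S] [AddCommGroup β] [AddCommGroup S]
    (P : Measure Ω) [IsProbabilityMeasure P]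
    (A : Ω → α) (B C : Ω → β) (W V : Ω → S) (f : α → β) (g : α → S)
    (hA : ∀ a, MeasurableSet (A ⁻¹' {a}))
    (h1 : ∀ a b, P (A ⁻¹' {a} ∩ B ⁻¹' {b}) = P (A ⁻¹' {a}) * P (B ⁻¹' {b}))
    (h2 : ∀ a b w, P (A ⁻¹' {a} ∩ (W ⁻¹' {w} ∩ B ⁻¹' {b})) =
      P (A ⁻¹' {a}) * P (W ⁻¹' {w} ∩ B ⁻¹' {b}))
    (hC : ∀ ω, C ω = f (A ω) + B ω) (hV : ∀ ω, V ω = g (A ω) + W ω) :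
    condEnt P V (fun ω => (A ω, C ω)) = condEnt P W B := by
  have hsum : ∑ a : α, (P (A ⁻¹' {a})).toReal = 1 := by
    have h := sum_measure_preimage_singleton (μ := P) (f := A) Finset.univ (fun a _ => hA a)
    rw [← ENNReal.toReal_sum (fun a _ => measure_ne_top P _), h]
    simp
  have e1 : ∀ a b, (fun ω => (A ω, C ω)) ⁻¹' {(a, f a + b)} = A ⁻¹' {a} ∩ B ⁻¹' {b} := by
    intro a b
    ext ω
    simp only [Set.mem_preimage, Set.mem_singleton_iff, Prod.mk.injEq, Set.mem_inter_iff, hC]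
    constructor
    · rintro ⟨rfl, h⟩
      exact ⟨rfl, add_left_cancel h⟩
    · rintro ⟨rfl, rfl⟩
      exact ⟨rfl, rfl⟩
  have e2 : ∀ a b w, V ⁻¹' {g a + w} ∩ (A ⁻¹' {a} ∩ B ⁻¹' {b}) =
      A ⁻¹' {a} ∩ (W ⁻¹' {w} ∩ B ⁻¹' {b}) := by
    intro a b w
    ext ω
    simp only [Set.mem_preimage, Set.mem_singleton_iff, Set.mem_inter_iff, hV]
    constructor
    · rintro ⟨h, rfl, h'⟩
      exact ⟨rfl, add_left_cancel h, h'⟩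
    · rintro ⟨rfl, rfl, h'⟩
      exact ⟨rfl, rfl, h'⟩
  unfold condEnt
  rw [Fintype.sum_prod_type]
  rw [← one_mul (∑ t : β, _), ← hsum, Finset.sum_mul]
  refine Finset.sum_congr rfl fun a _ => ?_
  rw [Finset.mul_sum, ← Equiv.sum_comp (Equiv.addLeft (f a))]
  refine Finset.sum_congr rfl fun b _ => ?_
  simp only [Equiv.coe_addLeft]
  rw [e1, h1, ENNReal.toReal_mul, mul_assoc]
  by_cases h0 : (P (A ⁻¹' {a})).toReal = 0
  · simp [h0]
  congr 2
  rw [← Equiv.sum_comp (Equiv.addLeft (g a))]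
  refine Finset.sum_congr rfl fun w _ => ?_
  simp only [Equiv.coe_addLeft]
  rw [e2, h2, ENNReal.toReal_mul, mul_div_mul_left _ _ h0]

/-- Let `X_1,…,X_n` and `Z_1,…,Z_n` be `ZMod 2`-valued random variables
with the vector `(X_1,…,X_n)` independent of the vector `(Z_1,…,Z_n)`, and let
`Y_i = X_i + Z_i` (mod 2). Then for every `i`,
`H[Y_i | (X_1,…,X_i, Y_1,…,Y_{i-1})] = H[Z_i | (Z_1,…,Z_{i-1})]`. -/
theorem condEnt_output_eq_condEnt_noise
    {Ω : Type*} [MeasurableSpace Ω] (P : Measure Ω) [IsProbabilityMeasure P]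
    (n : ℕ) (X Z : Fin n → Ω → ZMod 2)
    (hX : ∀ i, Measurable (X i)) (hZ : ∀ i, Measurable (Z i))
    (hindep : IndepFun (fun ω (i : Fin n) => X i ω) (fun ω (i : Fin n) => Z i ω) P)
    (Y : Fin n → Ω → ZMod 2) (hY : ∀ i ω, Y i ω = X i ω + Z i ω)
    (i : Fin n) :
    condEnt P (Y i)
        (fun ω =>
          ((fun j : Fin (i.val + 1) => X (Fin.castLE i.isLt j) ω),
           (fun j : Fin i.val => Y (Fin.castLE i.isLt.le j) ω))) =
      condEnt P (Z i) (fun ω => fun j : Fin i.val => Z (Fin.castLE i.isLt.le j) ω) := by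
  have hX' : Measurable (fun ω (i : Fin n) => X i ω) := measurable_pi_lambda _ hX
  have key : ∀ (s : Set (Fin n → ZMod 2)) (t : Set (Fin n → ZMod 2)),
      P ((fun ω (i : Fin n) => X i ω) ⁻¹' s ∩ (fun ω (i : Fin n) => Z i ω) ⁻¹' t) =
      P ((fun ω (i : Fin n) => X i ω) ⁻¹' s) * P ((fun ω (i : Fin n) => Z i ω) ⁻¹' t) :=
    fun s t => hindep.measure_inter_preimage_eq_mul _ _
      (Set.toFinite s).measurableSet (Set.toFinite t).measurableSet
  refine condEnt_translate_aux P
    (fun ω => (fun j : Fin (i.val + 1) => X (Fin.castLE i.isLt j) ω))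
    (fun ω => fun j : Fin i.val => Z (Fin.castLE i.isLt.le j) ω)
    (fun ω => fun j : Fin i.val => Y (Fin.castLE i.isLt.le j) ω)
    (Z i) (Y i) (fun a j => a j.castSucc) (fun a => a (Fin.last _)) ?_ ?_ ?_ ?_ ?_
  · intro a
    exact hX' (Set.toFinite
      ((fun (x : Fin n → ZMod 2) (j : Fin (i.val + 1)) => x (Fin.castLE i.isLt j)) ⁻¹'
        {a})).measurableSet
  · intro a b
    exact key ((fun x j => x (Fin.castLE i.isLt j)) ⁻¹' {a})
      ((fun x j => x (Fin.castLE i.isLt.le j)) ⁻¹' {b})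
  · intro a b w
    exact key ((fun x j => x (Fin.castLE i.isLt j)) ⁻¹' {a})
      ((fun x => x i) ⁻¹' {w} ∩ (fun x j => x (Fin.castLE i.isLt.le j)) ⁻¹' {b})
  · intro ω
    funext j
    exact hY _ ω
  · intro ω
    exact hY i ω
end
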